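/- arXiv:1706.08765 — 2 statements merged into one kernel-verified Lean document; each statement's English description precedes it below -/
import Mathlib

section
/- If β ∈ R^+ satisfies c_j(β) ≥ 1 and (β, α_i) ≥ 0 for every i ≠ j, then c_i(β) ≥ 1 for every i ∈ {1, …, n}. -/
open RealInnerProductSpace

section RootCoordinates

variable {V : Type*} [NormedAddCommGroup V] [InnerProductSpace ℝ V] {R : Set V} {n : ℕ}
  {α : Fin n → V} {c : V → Fin n → ℤ}

theorem coeff_eq_of_eq_sum (hαind : LinearIndependent ℝ α)
    (hc : ∀ β ∈ R, β = ∑ i, (c β i : ℝ) • α i) {γ : V} (hγ : γ ∈ R) {d : Fin n → ℤ}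
    (h : γ = ∑ i, (d i : ℝ) • α i) : c γ = d := by
  have hsum : ∑ i, ((c γ i : ℝ) - d i) • α i = 0 := by
    simp only [sub_smul, Finset.sum_sub_distrib]
    rw [← hc γ hγ, ← h, sub_self]
  ext i
  have hi := Fintype.linearIndependent_iff.mp hαind _ hsum i
  exact_mod_cast sub_eq_zero.mp hi

theorem coeff_simple (hαind : LinearIndependent ℝ α)
    (hc : ∀ β ∈ R, β = ∑ i, (c β i : ℝ) • α i) {k : Fin n} (hk : α k ∈ R) :
    c (α k) = Pi.single k 1 :=
  coeff_eq_of_eq_sum hαind hc hk (by simp [Pi.single_apply, ite_smul])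

theorem coeff_neg (hαind : LinearIndependent ℝ α)
    (hc : ∀ β ∈ R, β = ∑ i, (c β i : ℝ) • α i) {γ : V} (hγ : γ ∈ R) (hγ' : -γ ∈ R) :
    c (-γ) = -c γ :=
  coeff_eq_of_eq_sum hαind hc hγ' (by
    conv_lhs => rw [hc γ hγ]
    simp [Finset.sum_neg_distrib])

theorem inner_eq_sum_coeff (hc : ∀ β ∈ R, β = ∑ i, (c β i : ℝ) • α i) {γ : V} (hγ : γ ∈ R)
    (v : V) : ⟪γ, v⟫ = ∑ i, (c γ i : ℝ) * ⟪α i, v⟫ := by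
  conv_lhs => rw [hc γ hγ]
  simp [sum_inner, real_inner_smul_left]

/-- Reflecting a root in a simple root changes only one coordinate. -/
theorem exists_simple_reflection_coeff (hR0 : (0 : V) ∉ R)
    (hRrefl : ∀ β ∈ R, ∀ γ ∈ R, γ - (2 * ⟪γ, β⟫ / ⟪β, β⟫) • β ∈ R)
    (hRcrys : ∀ β ∈ R, ∀ γ ∈ R, ∃ k : ℤ, 2 * ⟪γ, β⟫ / ⟪β, β⟫ = (k : ℝ))
    (hαind : LinearIndependent ℝ α)
    (hc : ∀ β ∈ R, β = ∑ i, (c β i : ℝ) • α i) {γ : V} (hγ : γ ∈ R)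
    {i : Fin n} (hi : α i ∈ R) :
    ∃ δ ∈ R, ∃ m : ℤ, (m : ℝ) * ⟪α i, α i⟫ = 2 * ⟪γ, α i⟫ ∧
      c δ = c γ - Pi.single i m := by
  obtain ⟨m, hm⟩ := hRcrys _ hi _ hγ
  have hδ := hRrefl _ hi _ hγ
  rw [hm] at hδ
  have hne : ⟪α i, α i⟫ ≠ 0 := inner_self_ne_zero.mpr fun h => hR0 (h ▸ hi)
  refine ⟨_, hδ, m, by rw [← hm]; field_simp, coeff_eq_of_eq_sum hαind hc hδ ?_⟩
  conv_lhs => rw [hc γ hγ]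
  simp only [Pi.sub_apply, Int.cast_sub, sub_smul, Finset.sum_sub_distrib]
  congr 1
  rw [Finset.sum_eq_single i (fun b _ hb => by simp [hb]) (by simp)]
  simp

theorem inner_simple_nonpos (hR0 : (0 : V) ∉ R)
    (hRrefl : ∀ β ∈ R, ∀ γ ∈ R, γ - (2 * ⟪γ, β⟫ / ⟪β, β⟫) • β ∈ R)
    (hRcrys : ∀ β ∈ R, ∀ γ ∈ R, ∃ k : ℤ, 2 * ⟪γ, β⟫ / ⟪β, β⟫ = (k : ℝ))
    (hα : ∀ i, α i ∈ R) (hαind : LinearIndependent ℝ α)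
    (hc : ∀ β ∈ R, β = ∑ i, (c β i : ℝ) • α i)
    (hbase : ∀ β ∈ R, (∀ i, 0 ≤ c β i) ∨ (∀ i, c β i ≤ 0)) {k i : Fin n} (hki : k ≠ i) :
    ⟪α k, α i⟫ ≤ 0 := by
  obtain ⟨δ, hδ, m, hm, hcδ⟩ :=
    exists_simple_reflection_coeff hR0 hRrefl hRcrys hαind hc (hα k) (hα i)
  rw [coeff_simple hαind hc (hα k)] at hcδ
  have hk : c δ k = 1 := by simp [hcδ, hki]
  have hi : c δ i = -m := by simp [hcδ, hki.symm]
  have hm0 : m ≤ 0 := by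
    rcases hbase δ hδ with h | h
    · have := h i
      omega
    · have := h k
      omega
  have hm0' : (m : ℝ) ≤ 0 := by exact_mod_cast hm0
  have := mul_nonpos_of_nonpos_of_nonneg hm0' (real_inner_self_nonneg (x := α i))
  linarith

/-- If the simple roots are coloured so that differently coloured ones are orthogonal, then the
support of every positive root is monochromatic. -/
theorem color_eq_of_coeff_ne_zero_of_nonneg (hR0 : (0 : V) ∉ R)
    (hRrefl : ∀ β ∈ R, ∀ γ ∈ R, γ - (2 * ⟪γ, β⟫ / ⟪β, β⟫) • β ∈ R)
    (hRcrys : ∀ β ∈ R, ∀ γ ∈ R, ∃ k : ℤ, 2 * ⟪γ, β⟫ / ⟪β, β⟫ = (k : ℝ))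
    (hα : ∀ i, α i ∈ R) (hαind : LinearIndependent ℝ α)
    (hc : ∀ β ∈ R, β = ∑ i, (c β i : ℝ) • α i)
    (hbase : ∀ β ∈ R, (∀ i, 0 ≤ c β i) ∨ (∀ i, c β i ≤ 0))
    {κ : Type*} (f : Fin n → κ) (hf : ∀ a b, f a ≠ f b → ⟪α a, α b⟫ = 0)
    {γ : V} (hγ : γ ∈ R) (hpos : ∀ i, 0 ≤ c γ i)
    {a b : Fin n} (ha : c γ a ≠ 0) (hb : c γ b ≠ 0) : f a = f b := by
  induction hN : (∑ i, c γ i).toNat using Nat.strong_induction_on generalizing γ a b with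
  | _ N ih =>
  subst hN
  by_contra hab
  obtain ⟨i, hi⟩ : ∃ i, 0 < (c γ i : ℝ) * ⟪γ, α i⟫ := by
    by_contra! h
    have hle : ⟪γ, γ⟫ ≤ 0 := by
      rw [inner_eq_sum_coeff hc hγ]
      exact Finset.sum_nonpos fun i _ => by simpa [real_inner_comm] using h i
    exact hR0 (real_inner_self_nonpos.mp hle ▸ hγ)
  have hci : (0 : ℝ) ≤ c γ i := by exact_mod_cast hpos i
  have hin : 0 < ⟪γ, α i⟫ := pos_of_mul_pos_right hi hci
  have hci0 : c γ i ≠ 0 := fun h => by simp [h] at hi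
  obtain ⟨b', hb', hfb⟩ : ∃ b', c γ b' ≠ 0 ∧ f b' ≠ f i := by
    by_cases h : f a = f i
    · exact ⟨b, hb, fun h' => hab (h.trans h'.symm)⟩
    · exact ⟨a, ha, h⟩
  obtain ⟨δ, hδ, m, hm, hcδ⟩ :=
    exists_simple_reflection_coeff hR0 hRrefl hRcrys hαind hc hγ (hα i)
  have hself : 0 < ⟪α i, α i⟫ := real_inner_self_pos.mpr fun h => hR0 (h ▸ hα i)
  have hm0 : 0 < m := by
    have : 0 < (m : ℝ) * ⟪α i, α i⟫ := by linarith
    exact_mod_cast pos_of_mul_pos_left this hself.le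
  have hδne : ∀ k, k ≠ i → c δ k = c γ k := fun k hk => by simp [hcδ, hk]
  have hδi : c δ i = c γ i - m := by simp [hcδ]
  have hbi : b' ≠ i := fun h => hfb (h ▸ rfl)
  have hδb : c δ b' ≠ 0 := by rwa [hδne b' hbi]
  have hδpos : ∀ k, 0 ≤ c δ k := (hbase δ hδ).resolve_right fun h => by
    have h1 := h b'
    have h2 := hpos b'
    rw [hδne b' hbi] at h1
    omega
  have hsum : ∑ k, c δ k = ∑ k, c γ k - m := by
    simp [hcδ, Finset.sum_sub_distrib]
  have hδsum : 0 ≤ ∑ k, c δ k := Finset.sum_nonneg fun k _ => hδpos k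
  have hzero : ∀ k, f k = f i → c δ k = 0 := fun k hk => by
    by_contra hne
    exact hfb ((ih _ (by omega) hδ hδpos hδb hne rfl).trans hk)
  have hinner : ⟪γ, α i⟫ = c γ i * ⟪α i, α i⟫ := by
    rw [inner_eq_sum_coeff hc hγ, Finset.sum_eq_single i _ (by simp)]
    intro k _ hk
    by_cases hfk : f k = f i
    · simp [← hδne k hk, hzero k hfk]
    · simp [hf k i hfk]
  have hmi : c γ i = m := by
    have := hzero i rfl
    omega
  rw [hinner, hmi] at hm
  have : 0 < (m : ℝ) * ⟪α i, α i⟫ := mul_pos (by exact_mod_cast hm0) hself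
  linarith

end RootCoordinates

/-- If β ∈ R⁺ has c_j(β) ≥ 1 and (β, α_i) ≥ 0 for every i ≠ j, then
c_i(β) ≥ 1 for every i. -/
theorem statement3
    {V : Type*} [NormedAddCommGroup V] [InnerProductSpace ℝ V] [FiniteDimensional ℝ V]
    (R : Set V) (hRfin : R.Finite) (hR0 : (0 : V) ∉ R)
    (hRspan : Submodule.span ℝ R = ⊤)
    (hRneg : ∀ β ∈ R, -β ∈ R)
    (hRrefl : ∀ β ∈ R, ∀ γ ∈ R, γ - (2 * ⟪γ, β⟫ / ⟪β, β⟫) • β ∈ R)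
    (hRcrys : ∀ β ∈ R, ∀ γ ∈ R, ∃ k : ℤ, 2 * ⟪γ, β⟫ / ⟪β, β⟫ = (k : ℝ))
    (hRred : ∀ β ∈ R, ∀ s : ℝ, s • β ∈ R → s = 1 ∨ s = -1)
    (hRirr : ∀ R₁ R₂ : Set V, R = R₁ ∪ R₂ → (∀ a ∈ R₁, ∀ b ∈ R₂, ⟪a, b⟫ = 0) →
      R₁ = ∅ ∨ R₂ = ∅)
    (n : ℕ) (α : Fin n → V) (hα : ∀ i, α i ∈ R)
    (hαind : LinearIndependent ℝ α)
    (c : V → Fin n → ℤ)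
    (hc : ∀ β ∈ R, β = ∑ i, (c β i : ℝ) • α i)
    (hbase : ∀ β ∈ R, (∀ i, 0 ≤ c β i) ∨ (∀ i, c β i ≤ 0))
    (Rpos : Set V) (hRpos : Rpos = {β ∈ R | ∀ i, 0 ≤ c β i})
    (θ : V) (hθ : θ ∈ R) (hθhigh : ∀ β ∈ R, ∀ i, c β i ≤ c θ i)
    (j : Fin n) (haj : 2 ≤ c θ j)
    (β : V) (hβ : β ∈ Rpos) (hβj : 1 ≤ c β j)
    (hβdom : ∀ i, i ≠ j → 0 ≤ ⟪β, α i⟫) :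
    ∀ i, 1 ≤ c β i := by
  subst hRpos
  obtain ⟨hβR, hβpos⟩ := hβ
  have hcolor : ∀ k i, (c β k = 0) ≠ (c β i = 0) → ⟪α k, α i⟫ = 0 := by
    have hkey : ∀ i, c β i = 0 → ∀ k, c β k ≠ 0 → ⟪α k, α i⟫ = 0 := by
      intro i hi k hk
      have hterm : ∀ l ∈ Finset.univ, (c β l : ℝ) * ⟪α l, α i⟫ ≤ 0 := by
        intro l _
        by_cases hli : l = i
        · simp [hli, hi]
        · exact mul_nonpos_of_nonneg_of_nonpos (by exact_mod_cast hβpos l)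
            (inner_simple_nonpos hR0 hRrefl hRcrys hα hαind hc hbase hli)
      have hij : i ≠ j := by
        rintro rfl
        omega
      have hsum := hβdom i hij
      rw [inner_eq_sum_coeff hc hβR] at hsum
      have hz := (Finset.sum_eq_zero_iff_of_nonpos hterm).mp
        (le_antisymm (Finset.sum_nonpos hterm) hsum) k (Finset.mem_univ k)
      exact (mul_eq_zero.mp hz).resolve_left (by exact_mod_cast hk)
    intro k i hki
    by_cases hi : c β i = 0
    · exact hkey i hi k fun hk => hki (by simp [hk, hi])
    · rw [real_inner_comm]
      exact hkey k (by by_contra hk; exact hki (by simp [hk, hi])) i hi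
  have hmono : ∀ γ ∈ R, ∀ a b, c γ a ≠ 0 → c γ b ≠ 0 → (c β a = 0) = (c β b = 0) := by
    intro γ hγ a b ha hb
    rcases hbase γ hγ with h | h
    · exact color_eq_of_coeff_ne_zero_of_nonneg hR0 hRrefl hRcrys hα hαind hc hbase
        (fun i => c β i = 0) hcolor hγ h ha hb
    · have hn := coeff_neg hαind hc hγ (hRneg γ hγ)
      exact color_eq_of_coeff_ne_zero_of_nonneg hR0 hRrefl hRcrys hα hαind hc hbase
        (fun i => c β i = 0) hcolor (hRneg γ hγ) (by simpa [hn] using h)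
        (by simpa [hn] using ha) (by simpa [hn] using hb)
  by_contra! hex
  obtain ⟨i, hi⟩ := hex
  have hi0 : c β i = 0 := by
    have := hβpos i
    omega
  have hcover : R = {γ ∈ R | ∀ k, c β k = 0 → c γ k = 0} ∪
      {γ ∈ R | ∀ k, c β k ≠ 0 → c γ k = 0} := by
    ext γ
    refine ⟨fun hγ => ?_, by rintro (h | h) <;> exact h.1⟩
    by_cases h : ∀ k, c β k = 0 → c γ k = 0
    · exact Or.inl ⟨hγ, h⟩
    · push Not at h
      obtain ⟨k, hk, hγk⟩ := h
      refine Or.inr ⟨hγ, fun l hl => ?_⟩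
      by_contra hγl
      exact hl ((hmono γ hγ k l hγk hγl).mp hk)
  have horth : ∀ γ ∈ {γ ∈ R | ∀ k, c β k = 0 → c γ k = 0},
      ∀ δ ∈ {γ ∈ R | ∀ k, c β k ≠ 0 → c γ k = 0}, ⟪γ, δ⟫ = 0 := by
    rintro γ ⟨hγ, hγ0⟩ δ ⟨hδ, hδ0⟩
    rw [inner_eq_sum_coeff hc hγ]
    refine Finset.sum_eq_zero fun k _ => ?_
    by_cases hk : c β k = 0
    · simp [hγ0 k hk]
    · rw [real_inner_comm, inner_eq_sum_coeff hc hδ]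
      refine mul_eq_zero_of_right _ (Finset.sum_eq_zero fun l _ => ?_)
      by_cases hl : c β l = 0
      · rw [hcolor l k (by simp [hk, hl]), mul_zero]
      · simp [hδ0 l hl]
  rcases hRirr _ _ hcover horth with h | h
  · refine Set.eq_empty_iff_forall_notMem.mp h (α j) ⟨hα j, fun k hk => ?_⟩
    have hkj : k ≠ j := by
      rintro rfl
      omega
    simp [coeff_simple hαind hc (hα j), hkj]
  · refine Set.eq_empty_iff_forall_notMem.mp h (α i) ⟨hα i, fun k hk => ?_⟩
    have hki : k ≠ i := by
      rintro rfl
      exact hk hi0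
    simp [coeff_simple hαind hc (hα i), hki]
end

section
/- Suppose β_0, β_1, …, β_k ∈ R and indices i_0, …, i_k ∈ {1, …, n} satisfy: β_0 = α_0; for every 0 ≤ p < k, β_p ∉ Δ, (β_p, α_{i_p}) > 0, and β_{p+1} = s_{i_p}(β_p) (the reflection in α_{i_p} applied to β_p); and β_k = α_{i_k}. Then α_0^∨ = Σ_{r=0}^k α_{i_r}^∨; equivalently, for every i ∈ {1, …, n}, the number of indices r with 0 ≤ r ≤ k and i_r = i equals c_i^∨(α_0). -/
open RealInnerProductSpace

section RootSystem

variable {V : Type*} [NormedAddCommGroup V] [InnerProductSpace ℝ V]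

theorem inner_reflect_self {β : V} (hβ : β ≠ 0) (γ : V) :
    ⟪γ - (2 * ⟪γ, β⟫ / ⟪β, β⟫) • β, γ - (2 * ⟪γ, β⟫ / ⟪β, β⟫) • β⟫ = ⟪γ, γ⟫ := by
  have h : ⟪β, β⟫ ≠ 0 := inner_self_ne_zero.2 hβ
  simp only [inner_sub_left, inner_sub_right, inner_smul_left, inner_smul_right,
    real_inner_comm γ β, RCLike.conj_to_real]
  field_simp
  ring

theorem two_mul_inner_div_eq_one {β γ : V} (hγβ : ⟪γ, γ⟫ ≤ ⟪β, β⟫) (hne : β ≠ γ)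
    (hpos : 0 < ⟪β, γ⟫) (hint : ∃ m : ℤ, 2 * ⟪γ, β⟫ / ⟪β, β⟫ = (m : ℝ)) :
    2 * ⟪γ, β⟫ / ⟪β, β⟫ = 1 := by
  obtain ⟨m, hm⟩ := hint
  have hβ : β ≠ 0 := by rintro rfl; simp at hpos
  have hb : 0 < ⟪β, β⟫ := real_inner_self_pos.2 hβ
  have hd : 0 < ⟪β - γ, β - γ⟫ := real_inner_self_pos.2 (sub_ne_zero.2 hne)
  have hexp : ⟪β - γ, β - γ⟫ = ⟪β, β⟫ - 2 * ⟪β, γ⟫ + ⟪γ, γ⟫ := real_inner_sub_sub_self β γ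
  have hcomm := real_inner_comm β γ
  have h0 : (0 : ℝ) < m := by
    rw [← hm]; exact div_pos (by linarith) hb
  have h2 : (m : ℝ) < 2 := by
    rw [← hm, div_lt_iff₀ hb]; linarith
  have h0' : 0 < m := by exact_mod_cast h0
  have h2' : m < 2 := by exact_mod_cast h2
  have : m = 1 := by omega
  rw [hm, this]; simp

/-- The coroot of a reflected root when the coroot pairing equals one. -/
theorem coroot_reflect {β γ : V} (hβ : β ≠ 0) (hγ : γ ≠ 0)
    (h1 : 2 * ⟪γ, β⟫ / ⟪β, β⟫ = 1) :
    (2 / ⟪β - (2 * ⟪β, γ⟫ / ⟪γ, γ⟫) • γ, β - (2 * ⟪β, γ⟫ / ⟪γ, γ⟫) • γ⟫) •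
        (β - (2 * ⟪β, γ⟫ / ⟪γ, γ⟫) • γ) =
      (2 / ⟪β, β⟫) • β - (2 / ⟪γ, γ⟫) • γ := by
  rw [inner_reflect_self hγ, smul_sub, smul_smul]
  congr 2
  have hb : ⟪β, β⟫ ≠ 0 := inner_self_ne_zero.2 hβ
  rw [div_eq_one_iff_eq hb] at h1
  rw [real_inner_comm β γ] at *
  rw [h1]
  field_simp

variable {n : ℕ} {R : Set V} {α : Fin n → V} {c : V → Fin n → ℤ}

theorem coeff_sub_smul (hαind : LinearIndependent ℝ α)
    (hc : ∀ β ∈ R, β = ∑ i, (c β i : ℝ) • α i) {β γ : V} (hβ : β ∈ R) (hγ : γ ∈ R) {t : ℝ}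
    (h : γ - t • β ∈ R) (i : Fin n) : (c (γ - t • β) i : ℝ) = c γ i - t * c β i := by
  have h1 : ∑ i, (c (γ - t • β) i : ℝ) • α i = ∑ i, ((c γ i : ℝ) - t * c β i) • α i := by
    rw [← hc _ h]
    simp only [sub_smul, Finset.sum_sub_distrib, mul_smul, ← Finset.smul_sum]
    rw [← hc _ hβ, ← hc _ hγ]
  exact Fintype.linearIndependent_iffₛ.1 hαind _ _ h1 i

theorem coeff_base (hαind : LinearIndependent ℝ α) (hα : ∀ i, α i ∈ R)
    (hc : ∀ β ∈ R, β = ∑ i, (c β i : ℝ) • α i) (i l : Fin n) :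
    c (α i) l = if l = i then 1 else 0 := by
  have h1 : ∑ l, (c (α i) l : ℝ) • α l = ∑ l, (if l = i then (1 : ℝ) else 0) • α l := by
    rw [← hc _ (hα i)]; simp
  have := Fintype.linearIndependent_iffₛ.1 hαind _ _ h1 l
  split_ifs at this ⊢ <;> exact_mod_cast this

theorem coeff_reflect_base (hαind : LinearIndependent ℝ α) (hα : ∀ i, α i ∈ R)
    (hc : ∀ β ∈ R, β = ∑ i, (c β i : ℝ) • α i) {γ : V} (hγ : γ ∈ R) {t : ℝ} {i : Fin n}
    (h : γ - t • α i ∈ R) (l : Fin n) :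
    (c (γ - t • α i) l : ℝ) = c γ l - if l = i then t else 0 := by
  rw [coeff_sub_smul hαind hc (hα i) hγ h, coeff_base hαind hα hc]
  split_ifs <;> simp

/-- The highest root has maximal length. -/
theorem inner_self_le_highest (hRfin : R.Finite) (hR0 : (0 : V) ∉ R)
    (hRrefl : ∀ β ∈ R, ∀ γ ∈ R, γ - (2 * ⟪γ, β⟫ / ⟪β, β⟫) • β ∈ R)
    (hα : ∀ i, α i ∈ R) (hαind : LinearIndependent ℝ α)
    (hc : ∀ β ∈ R, β = ∑ i, (c β i : ℝ) • α i)
    {θ : V} (hθ : θ ∈ R) (hθhigh : ∀ β ∈ R, ∀ i, c β i ≤ c θ i) {β : V} (hβ : β ∈ R) :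
    ⟪β, β⟫ ≤ ⟪θ, θ⟫ := by
  have hne : ∀ γ ∈ R, γ ≠ 0 := fun γ hγ h => hR0 (h ▸ hγ)
  have hpos : ∀ i, 0 < ⟪α i, α i⟫ := fun i => real_inner_self_pos.2 (hne _ (hα i))
  have hθdom : ∀ i, 0 ≤ ⟪θ, α i⟫ := by
    intro i
    have hm := hRrefl _ (hα i) _ hθ
    have h1 := coeff_reflect_base hαind hα hc hθ hm i
    have h2 := Int.cast_le (R := ℝ).2 (hθhigh _ hm i)
    rw [h1, if_pos rfl] at h2
    have h3 : 0 ≤ 2 * ⟪θ, α i⟫ / ⟪α i, α i⟫ := by linarith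
    by_contra! hlt
    exact absurd h3 (not_le.2 (div_neg_of_neg_of_pos (by linarith) (hpos i)))
  obtain ⟨δ, ⟨hδ, hδβ⟩, hmax⟩ := Set.exists_max_image {γ ∈ R | ⟪γ, γ⟫ = ⟪β, β⟫}
    (fun γ => ∑ i, c γ i) (hRfin.subset (Set.sep_subset _ _)) ⟨β, hβ, rfl⟩
  have hδdom : ∀ i, 0 ≤ ⟪δ, α i⟫ := by
    intro i
    by_contra! hlt
    have hm := hRrefl _ (hα i) _ hδ
    have h1 := hmax _ ⟨hm, (inner_reflect_self (hne _ (hα i)) δ).trans hδβ⟩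
    have h2 : ((∑ l, c (δ - (2 * ⟪δ, α i⟫ / ⟪α i, α i⟫) • α i) l : ℤ) : ℝ) ≤
      (∑ l, c δ l : ℤ) := by exact_mod_cast h1
    push_cast at h2
    simp only [coeff_reflect_base hαind hα hc hδ hm, Finset.sum_sub_distrib,
      Finset.sum_ite_eq', Finset.mem_univ, if_true] at h2
    have : 2 * ⟪δ, α i⟫ / ⟪α i, α i⟫ < 0 := div_neg_of_neg_of_pos (by linarith) (hpos i)
    linarith
  have hdiff : θ - δ = ∑ i, ((c θ i : ℝ) - c δ i) • α i := by
    simp only [sub_smul, Finset.sum_sub_distrib]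
    rw [← hc _ hθ, ← hc _ hδ]
  have hnonneg : ∀ v : V, (∀ i, 0 ≤ ⟪v, α i⟫) → 0 ≤ ⟪v, θ - δ⟫ := by
    intro v hv
    rw [hdiff, inner_sum]
    refine Finset.sum_nonneg fun i _ => ?_
    rw [inner_smul_right]
    have : (c δ i : ℝ) ≤ c θ i := by exact_mod_cast hθhigh _ hδ i
    exact mul_nonneg (by linarith) (hv i)
  have h1 := hnonneg θ hθdom
  have h2 := hnonneg δ hδdom
  rw [inner_sub_right] at h1 h2
  have := real_inner_comm θ δ
  linarith

/-- Some root of maximal length whose coefficient at `j` is that of the highest root is not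
orthogonal to a given root with that same coefficient. -/
theorem exists_inner_ne_zero [FiniteDimensional ℝ V] (hR0 : (0 : V) ∉ R)
    (hRrefl : ∀ β ∈ R, ∀ γ ∈ R, γ - (2 * ⟪γ, β⟫ / ⟪β, β⟫) • β ∈ R)
    (hα : ∀ i, α i ∈ R) (hαind : LinearIndependent ℝ α)
    (hc : ∀ β ∈ R, β = ∑ i, (c β i : ℝ) • α i)
    {θ : V} (hθ : θ ∈ R) {j : Fin n} (haj : c θ j ≠ 0)
    {α₀ : V} (hα₀ : α₀ ∈ R) (hα₀j : c α₀ j = c θ j) :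
    ∃ β ∈ R, c β j = c θ j ∧ ⟪β, β⟫ = ⟪θ, θ⟫ ∧ ⟪β, α₀⟫ ≠ 0 := by
  by_contra! hcon
  have hne : ∀ γ ∈ R, γ ≠ 0 := fun γ hγ h => hR0 (h ▸ hγ)
  set T : Set V := {β ∈ R | c β j = c θ j ∧ ⟪β, β⟫ = ⟪θ, θ⟫} with hT
  set U := Submodule.span ℝ T
  have hθU : θ ∈ U := Submodule.subset_span ⟨hθ, rfl, rfl⟩
  have horth : ∀ v : V, (∀ β ∈ T, ⟪β, v⟫ = 0) → U.starProjection v = 0 := by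
    intro v hv
    rw [Submodule.starProjection_apply_eq_zero_iff]
    rw [Submodule.mem_orthogonal]
    intro u hu
    induction hu using Submodule.span_induction with
    | mem x hx => exact hv x hx
    | zero => simp
    | add x y _ _ hx hy => rw [inner_add_left, hx, hy, add_zero]
    | smul a x _ hx => rw [inner_smul_left, hx, mul_zero]
  have hsimple : ∀ i, i ≠ j → U.starProjection (α i) = 0 ∨ U.starProjection (α i) = α i := by
    intro i hij
    by_cases h : ∀ β ∈ T, ⟪β, α i⟫ = 0
    · exact Or.inl (horth _ h)
    · right
      push Not at h
      obtain ⟨β, hβ, hβi⟩ := h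
      have hm := hRrefl _ (hα i) _ hβ.1
      have hmj := coeff_reflect_base hαind hα hc hβ.1 hm j
      rw [if_neg hij.symm, sub_zero] at hmj
      have hmT : β - (2 * ⟪β, α i⟫ / ⟪α i, α i⟫) • α i ∈ T :=
        ⟨hm, (by exact_mod_cast hmj : c _ j = c β j).trans hβ.2.1,
          (inner_reflect_self (hne _ (hα i)) β).trans hβ.2.2⟩
      have hU := U.sub_mem (Submodule.subset_span hβ) (Submodule.subset_span hmT)
      rw [sub_sub_cancel] at hU
      have ht : 2 * ⟪β, α i⟫ / ⟪α i, α i⟫ ≠ 0 :=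
        div_ne_zero (mul_ne_zero two_ne_zero hβi) (inner_self_ne_zero.2 (hne _ (hα i)))
      exact Submodule.starProjection_eq_self_iff.2 ((U.smul_mem_iff ht).1 hU)
  have hP : θ = ∑ i, ((c θ i : ℝ) - c α₀ i) • U.starProjection (α i) := by
    have h0 : U.starProjection α₀ = 0 := horth _ fun β hβ => hcon β hβ.1 hβ.2.1 hβ.2.2
    have h1 : U.starProjection θ = θ := Submodule.starProjection_eq_self_iff.2 hθU
    calc θ = U.starProjection (θ - α₀) := by rw [map_sub, h0, h1, sub_zero]
      _ = U.starProjection (∑ i, ((c θ i : ℝ) - c α₀ i) • α i) := by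
        congr 1
        simp only [sub_smul, Finset.sum_sub_distrib]
        rw [← hc _ hθ, ← hc _ hα₀]
      _ = _ := by simp only [map_sum, map_smul]
  have hmem : θ ∈ Submodule.span ℝ (α '' {j}ᶜ) := by
    rw [hP]
    refine Submodule.sum_mem _ fun i _ => ?_
    by_cases hij : i = j
    · subst hij
      simp [hα₀j]
    · refine Submodule.smul_mem _ _ ?_
      rcases hsimple i hij with h | h <;> rw [h]
      · exact Submodule.zero_mem _
      · exact Submodule.subset_span ⟨i, hij, rfl⟩
  rw [hc _ hθ, ← Finset.add_sum_erase _ _ (Finset.mem_univ j)] at hmem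
  have hrest : ∑ i ∈ Finset.univ.erase j, (c θ i : ℝ) • α i ∈
      Submodule.span ℝ (α '' {j}ᶜ) :=
    Submodule.sum_mem _ fun i hi =>
      Submodule.smul_mem _ _ (Submodule.subset_span ⟨i, Finset.ne_of_mem_erase hi, rfl⟩)
  have hj := (Submodule.add_mem_iff_left _ hrest).1 hmem
  rw [Submodule.smul_mem_iff _ (by exact_mod_cast haj)] at hj
  exact hαind.notMem_span_image (s := {j}ᶜ) (by simp) hj

/-- A root of minimal height among those with maximal coefficient at `j` has maximal length. -/
theorem inner_self_le_of_minimal_height [FiniteDimensional ℝ V]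
    (hRfin : R.Finite) (hR0 : (0 : V) ∉ R)
    (hRneg : ∀ β ∈ R, -β ∈ R)
    (hRrefl : ∀ β ∈ R, ∀ γ ∈ R, γ - (2 * ⟪γ, β⟫ / ⟪β, β⟫) • β ∈ R)
    (hRcrys : ∀ β ∈ R, ∀ γ ∈ R, ∃ k : ℤ, 2 * ⟪γ, β⟫ / ⟪β, β⟫ = (k : ℝ))
    (hα : ∀ i, α i ∈ R) (hαind : LinearIndependent ℝ α)
    (hc : ∀ β ∈ R, β = ∑ i, (c β i : ℝ) • α i)
    (hbase : ∀ β ∈ R, (∀ i, 0 ≤ c β i) ∨ (∀ i, c β i ≤ 0))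
    {θ : V} (hθ : θ ∈ R) (hθhigh : ∀ β ∈ R, ∀ i, c β i ≤ c θ i)
    {j : Fin n} (haj : 0 < c θ j)
    {α₀ : V} (hα₀ : α₀ ∈ R) (hα₀j : c α₀ j = c θ j)
    (hα₀min : ∀ β ∈ R, c β j = c θ j → ∑ i, c α₀ i ≤ ∑ i, c β i)
    {γ : V} (hγ : γ ∈ R) : ⟪γ, γ⟫ ≤ ⟪α₀, α₀⟫ := by
  refine (inner_self_le_highest hRfin hR0 hRrefl hα hαind hc hθ hθhigh hγ).trans ?_
  by_contra! hlt
  have hne : ∀ γ ∈ R, γ ≠ 0 := fun γ hγ h => hR0 (h ▸ hγ)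
  obtain ⟨β, hβ, hβj, hβθ, hβα⟩ :=
    exists_inner_ne_zero hR0 hRrefl hα hαind hc hθ haj.ne' hα₀ hα₀j
  have hneg : ∀ δ ∈ R, ∀ i, c (-δ) i = -c δ i := by
    intro δ hδ i
    have h : δ - (2 : ℝ) • δ = -δ := by rw [two_smul]; abel
    have := coeff_sub_smul hαind hc hδ hδ (t := 2) (h ▸ hRneg _ hδ) i
    rw [h] at this
    have h' : (c (-δ) i : ℝ) = -c δ i := by rw [this]; ring
    exact_mod_cast h'
  have hα₀pos : 0 < ⟪α₀, α₀⟫ := real_inner_self_pos.2 (hne _ hα₀)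
  obtain ⟨m, hm⟩ := hRcrys _ hα₀ _ hβ
  have hr := hRrefl _ hα₀ _ hβ
  rw [hm] at hr
  have hrc : ∀ i, c (β - (m : ℝ) • α₀) i = c β i - m * c α₀ i := fun i => by
    exact_mod_cast coeff_sub_smul hαind hc hα₀ hβ hr i
  have hmne : m ≠ 0 := by
    rintro rfl
    rw [Int.cast_zero, div_eq_zero_iff] at hm
    rcases hm with h | h
    · exact hβα (by linarith)
    · exact hα₀pos.ne' h
  have hup := hθhigh _ hr j
  have hlow := hθhigh _ (hRneg _ hr) j
  rw [hneg _ hr, hrc, hα₀j, hβj] at hlow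
  rw [hrc, hα₀j, hβj] at hup
  have hm0 : 0 < m := by
    rcases hmne.lt_or_gt with h | h
    · nlinarith
    · exact h
  have hm2 : m ≤ 2 := by nlinarith
  have hβα0 : 0 < ⟪β, α₀⟫ := by
    have : (0 : ℝ) < 2 * ⟪β, α₀⟫ / ⟪α₀, α₀⟫ := by rw [hm]; exact_mod_cast hm0
    have := (div_pos_iff_of_pos_right hα₀pos).1 this
    linarith
  have hβne : β ≠ α₀ := by
    rintro rfl
    exact hlt.ne hβθ
  have h1 : 2 * ⟪α₀, β⟫ / ⟪β, β⟫ = 1 :=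
    two_mul_inner_div_eq_one (by rw [hβθ]; exact hlt.le) hβne hβα0 (hRcrys _ hβ _ hα₀)
  have hm2' : m = 2 := by
    have hβpos : 0 < ⟪β, β⟫ := real_inner_self_pos.2 (hne _ hβ)
    rw [div_eq_one_iff_eq hβpos.ne'] at h1
    rw [div_eq_iff hα₀pos.ne', real_inner_comm, h1, hβθ] at hm
    have : (1 : ℝ) < m := by
      by_contra! h
      nlinarith
    have : 1 < m := by exact_mod_cast this
    omega
  have hd := hRrefl _ hβ _ hα₀
  rw [h1] at hd
  have hdc : ∀ i, c (α₀ - (1 : ℝ) • β) i = c α₀ i - c β i := fun i => by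
    have := coeff_sub_smul hαind hc hβ hα₀ hd i
    rw [one_mul] at this
    exact_mod_cast this
  have hht1 := hα₀min β hβ hβj
  have hht2 := hα₀min _ (hRneg _ hr) (by rw [hneg _ hr, hrc, hα₀j, hβj, hm2']; ring)
  simp only [hneg _ hr, hrc, Finset.sum_neg_distrib, Finset.sum_sub_distrib,
    ← Finset.mul_sum] at hht2
  rw [hm2'] at hht2
  have hsum : ∑ i, c (α₀ - (1 : ℝ) • β) i = 0 := by
    simp only [hdc, Finset.sum_sub_distrib]
    linarith
  have hzero : ∀ i, c (α₀ - (1 : ℝ) • β) i = 0 := by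
    rcases hbase _ hd with h | h
    · intro i
      exact (Finset.sum_eq_zero_iff_of_nonneg fun i _ => h i).1 hsum i (Finset.mem_univ i)
    · intro i
      exact (Finset.sum_eq_zero_iff_of_nonpos fun i _ => h i).1 hsum i (Finset.mem_univ i)
  refine hne _ hd ?_
  rw [hc _ hd]
  simp only [hzero, Int.cast_zero, zero_smul, Finset.sum_const_zero]

end RootSystem

/-- If β₀ = α₀, β_{p+1} = s_{i_p}(β_p) where β_p ∉ Δ and (β_p, α_{i_p}) > 0
for p < k, and β_k = α_{i_k}, then α₀^∨ = Σ_{r=0}^k α_{i_r}^∨; equivalently for every i the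
number of r with i_r = i equals c_i^∨(α₀). -/
theorem statement7
    {V : Type*} [NormedAddCommGroup V] [InnerProductSpace ℝ V] [FiniteDimensional ℝ V]
    (R : Set V) (hRfin : R.Finite) (hR0 : (0 : V) ∉ R)
    (hRspan : Submodule.span ℝ R = ⊤)
    (hRneg : ∀ β ∈ R, -β ∈ R)
    (hRrefl : ∀ β ∈ R, ∀ γ ∈ R, γ - (2 * ⟪γ, β⟫ / ⟪β, β⟫) • β ∈ R)
    (hRcrys : ∀ β ∈ R, ∀ γ ∈ R, ∃ k : ℤ, 2 * ⟪γ, β⟫ / ⟪β, β⟫ = (k : ℝ))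
    (hRred : ∀ β ∈ R, ∀ s : ℝ, s • β ∈ R → s = 1 ∨ s = -1)
    (hRirr : ∀ R₁ R₂ : Set V, R = R₁ ∪ R₂ → (∀ a ∈ R₁, ∀ b ∈ R₂, ⟪a, b⟫ = 0) →
      R₁ = ∅ ∨ R₂ = ∅)
    (n : ℕ) (α : Fin n → V) (hα : ∀ i, α i ∈ R)
    (hαind : LinearIndependent ℝ α)
    (c : V → Fin n → ℤ)
    (hc : ∀ β ∈ R, β = ∑ i, (c β i : ℝ) • α i)
    (hbase : ∀ β ∈ R, (∀ i, 0 ≤ c β i) ∨ (∀ i, c β i ≤ 0))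
    (Rpos : Set V) (hRpos : Rpos = {β ∈ R | ∀ i, 0 ≤ c β i})
    (θ : V) (hθ : θ ∈ R) (hθhigh : ∀ β ∈ R, ∀ i, c β i ≤ c θ i)
    (j : Fin n) (haj : 2 ≤ c θ j)
    (cv : V → Fin n → ℤ)
    (hcv : ∀ β ∈ R, (2 / ⟪β, β⟫) • β = ∑ i, (cv β i : ℝ) • ((2 / ⟪α i, α i⟫) • α i))
    (α₀ : V) (hα₀pos : α₀ ∈ Rpos) (hα₀j : c α₀ j = c θ j)
    (hα₀min : ∀ β ∈ Rpos, c β j = c θ j → ∑ i, c α₀ i ≤ ∑ i, c β i)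
    (k : ℕ) (β : ℕ → V) (idx : ℕ → Fin n)
    (hβR : ∀ p ≤ k, β p ∈ R)
    (hβ0 : β 0 = α₀)
    (hstep : ∀ p < k, (∀ i, β p ≠ α i) ∧ 0 < ⟪β p, α (idx p)⟫ ∧
      β (p + 1) = β p - (2 * ⟪β p, α (idx p)⟫ / ⟪α (idx p), α (idx p)⟫) • α (idx p))
    (hβk : β k = α (idx k)) :
    ((2 / ⟪α₀, α₀⟫) • α₀ =
        ∑ r ∈ Finset.range (k + 1), (2 / ⟪α (idx r), α (idx r)⟫) • α (idx r)) ∧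
    (∀ i, (((Finset.range (k + 1)).filter (fun r => idx r = i)).card : ℤ) = cv α₀ i) := by
  have hne : ∀ γ ∈ R, γ ≠ 0 := fun γ hγ h => hR0 (h ▸ hγ)
  subst hRpos
  have haj0 : 0 < c θ j := by omega
  have hα₀ : α₀ ∈ R := hα₀pos.1
  have hlong : ∀ γ ∈ R, ⟪γ, γ⟫ ≤ ⟪α₀, α₀⟫ := fun γ hγ =>
    inner_self_le_of_minimal_height hRfin hR0 hRneg hRrefl hRcrys hα hαind hc hbase hθ hθhigh
      haj0 hα₀ hα₀j (fun δ hδ hδj => hα₀min δ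
        ⟨hδ, (hbase δ hδ).resolve_right fun h => by have := h j; omega⟩ hδj) hγ
  have key : ∀ p ≤ k, ⟪β p, β p⟫ = ⟪α₀, α₀⟫ ∧ (2 / ⟪α₀, α₀⟫) • α₀ =
      (2 / ⟪β p, β p⟫) • β p +
        ∑ r ∈ Finset.range p, (2 / ⟪α (idx r), α (idx r)⟫) • α (idx r) := by
    intro p
    induction p with
    | zero => intro _; simp [hβ0]
    | succ p ih =>
      intro hp
      obtain ⟨hlen, hsum⟩ := ih (by omega)
      obtain ⟨hns, hpos, hnext⟩ := hstep p (by omega)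
      have hβp := hβR p (by omega)
      have h1 := two_mul_inner_div_eq_one (by rw [hlen]; exact hlong _ (hα (idx p)))
        (hns (idx p)) hpos (hRcrys _ hβp _ (hα (idx p)))
      refine ⟨?_, ?_⟩
      · rw [hnext, inner_reflect_self (hne _ (hα _)), hlen]
      · rw [hnext, coroot_reflect (hne _ hβp) (hne _ (hα _)) h1, hsum,
          Finset.sum_range_succ]
        abel
  have hmain : (2 / ⟪α₀, α₀⟫) • α₀ =
      ∑ r ∈ Finset.range (k + 1), (2 / ⟪α (idx r), α (idx r)⟫) • α (idx r) := by
    rw [(key k le_rfl).2, Finset.sum_range_succ, hβk, add_comm]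
  refine ⟨hmain, fun i => ?_⟩
  have hind : LinearIndependent ℝ fun i => (2 / ⟪α i, α i⟫) • α i :=
    hαind.units_smul fun i => Units.mk0 (2 / ⟪α i, α i⟫)
      (div_ne_zero two_ne_zero (inner_self_ne_zero.2 (hne _ (hα i))))
  have hcount : ∑ i, (((Finset.range (k + 1)).filter fun r => idx r = i).card : ℝ) •
      ((2 / ⟪α i, α i⟫) • α i) = ∑ i, (cv α₀ i : ℝ) • ((2 / ⟪α i, α i⟫) • α i) := by
    rw [← hcv _ hα₀, hmain, ← Finset.sum_fiberwise (Finset.range (k + 1)) idx]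
    refine Finset.sum_congr rfl fun i _ => ?_
    rw [Finset.sum_congr rfl fun r hr => by rw [(Finset.mem_filter.1 hr).2],
      Finset.sum_const, Nat.cast_smul_eq_nsmul]
  exact_mod_cast Fintype.linearIndependent_iffₛ.1 hind _ _ hcount i
end
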